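/- If λ = (λ₁,…,λ_n) ∈ ℝⁿ has pairwise distinct, strictly negative entries, then every Vandermonde basis function is nonnegative: v_{k,λ}(t) ≥ 0 for all t ≥ 0 and all k = 0,…,n-1. -/

import Mathlib

open Finset

noncomputable def acoef {R : Type*} [CommRing R] {n : ℕ} (lam : Fin n → R) (k : ℤ) : R :=
  if 0 ≤ k ∧ k ≤ (n : ℤ) then
    (-1 : R) ^ (n - k.toNat) *
      ∑ I ∈ Finset.univ.powersetCard (n - k.toNat), ∏ i ∈ I, lam i
  else 0

def removeEntry {α : Type*} {n : ℕ} (lam : Fin n → α) (i : Fin n) : Fin (n - 1) → α :=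
  fun j => lam (Fin.cast (Nat.succ_pred_eq_of_pos i.pos)
    ((Fin.cast (Nat.succ_pred_eq_of_pos i.pos).symm i).succAbove j))


noncomputable def vbasisR {n : ℕ} (lam : Fin n → ℝ) (k : ℤ) (t : ℝ) : ℝ :=
  (-1 : ℝ) ^ (n - 1) *
    ∑ i : Fin n, acoef (removeEntry lam i) k /
      (∏ j ∈ Finset.univ.erase i, (lam j - lam i)) * Real.exp (lam i * t)

open Polynomial Lagrange in
/-- Newton's form of the Lagrange interpolant: adding one node to the interpolation problem. -/
theorem interpolate_insert_eq_add_nodal {ι F : Type*} [DecidableEq ι] [Field F] {s : Finset ι}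
    {v : ι → F} (r : ι → F) {a : ι} (ha : a ∉ s) (hv : ∀ i ∈ s, v i ≠ v a) :
    interpolate (insert a s) v r = interpolate s v r +
      C (∑ i ∈ insert a s, nodalWeight (insert a s) v i * r i) * nodal s v := by
  have key : ∀ i ∈ s, C (r i) * Lagrange.basis (insert a s) v i =
      C (r i) * Lagrange.basis s v i + C (nodalWeight (insert a s) v i * r i) * nodal s v := by
    intro i hi
    have hia : i ≠ a := fun h => ha (h ▸ hi)
    have hne : v i - v a ≠ 0 := sub_ne_zero.mpr (hv i hi)
    have hw : nodalWeight s v i = nodalWeight (insert a s) v i * (v i - v a) := by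
      rw [nodalWeight, nodalWeight, erase_insert_of_ne hia.symm,
        prod_insert (fun h => ha (mem_of_mem_erase h))]
      field_simp
    rw [basis_eq_prod_sub_inv_mul_nodal_div hi,
      basis_eq_prod_sub_inv_mul_nodal_div (mem_insert_of_mem hi), ← nodal_erase_eq_nodal_div hi,
      ← nodal_erase_eq_nodal_div (mem_insert_of_mem hi), erase_insert_of_ne hia.symm,
      nodal_insert_eq_nodal (fun h => ha (mem_of_mem_erase h)), nodal_eq_mul_nodal_erase hi, hw]
    simp only [map_mul, map_sub]
    ring
  have key_a : C (r a) * Lagrange.basis (insert a s) v a =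
      C (nodalWeight (insert a s) v a * r a) * nodal s v := by
    rw [basis_eq_prod_sub_inv_mul_nodal_div (mem_insert_self a s),
      ← nodal_erase_eq_nodal_div (mem_insert_self a s), erase_insert ha, map_mul]
    ring
  rw [interpolate_apply, interpolate_apply, sum_insert ha, sum_insert ha, sum_congr rfl key,
    sum_add_distrib, key_a, map_add, map_sum, add_mul, sum_mul]
  ring

open Polynomial Lagrange in
theorem sum_nodalWeight_nonneg {ι : Type*} [DecidableEq ι] {s : Finset ι} {v : ι → ℝ}
    (hv : Set.InjOn v s) : 0 ≤ ∑ i ∈ s, nodalWeight s v i := by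
  rcases s.eq_empty_or_nonempty with rfl | hs
  · simp
  have h := coeff_eq_sum hv (P := 1) (by
    rw [degree_one]; exact_mod_cast hs.card_pos)
  simp only [eval_one, one_div] at h
  simp only [nodalWeight, prod_inv_distrib]
  rw [← h, coeff_one]
  split_ifs <;> norm_num

open Lagrange in
/-- The divided differences of `x ↦ exp (x * t)` are nonnegative for `0 ≤ t`. -/
theorem sum_nodalWeight_mul_exp_nonneg {ι : Type*} [DecidableEq ι] {s : Finset ι} {v : ι → ℝ}
    (hv : Set.InjOn v s) {t : ℝ} (ht : 0 ≤ t) :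
    0 ≤ ∑ i ∈ s, nodalWeight s v i * Real.exp (v i * t) := by
  induction s using Finset.induction_on generalizing t with
  | empty => simp
  | insert a s ha ih =>
    have hvs : Set.InjOn v s := hv.mono (by simp)
    let g : ℝ → ℝ := fun x =>
      ∑ i ∈ insert a s, nodalWeight (insert a s) v i * Real.exp ((v i - v a) * x)
    have hg : ∀ x, HasDerivAt g
        (Real.exp (-(v a * x)) * ∑ i ∈ s, nodalWeight s v i * Real.exp (v i * x)) x := by
      intro x
      have hsum : HasDerivAt g (∑ i ∈ insert a s, nodalWeight (insert a s) v i *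
          (Real.exp ((v i - v a) * x) * (v i - v a))) x :=
        HasDerivAt.fun_sum fun i _ =>
          (((hasDerivAt_id x).const_mul (v i - v a)).exp.const_mul _).congr_deriv (by simp)
      refine hsum.congr_deriv ?_
      rw [sum_insert ha, sub_self, mul_zero, mul_zero, zero_add, mul_sum]
      refine sum_congr rfl fun i hi => ?_
      have hia : i ≠ a := fun h => ha (h ▸ hi)
      have hne : v i - v a ≠ 0 := sub_ne_zero.mpr fun h =>
        hia (hv (by simp [hi]) (by simp) h)
      rw [nodalWeight, nodalWeight, erase_insert_of_ne hia.symm,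
        prod_insert (fun h => ha (mem_of_mem_erase h)),
        show (v i - v a) * x = -(v a * x) + v i * x by ring, Real.exp_add]
      field_simp
    have hmono : MonotoneOn g (Set.Ici 0) := by
      refine monotoneOn_of_deriv_nonneg (convex_Ici 0)
        (fun x _ => (hg x).continuousAt.continuousWithinAt)
        (fun x _ => (hg x).differentiableAt.differentiableWithinAt) fun x hx => ?_
      rw [interior_Ici, Set.mem_Ioi] at hx
      rw [(hg x).deriv]
      exact mul_nonneg (Real.exp_pos _).le (ih hvs hx.le)
    have hg0 : 0 ≤ g 0 := by simpa [g] using sum_nodalWeight_nonneg hv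
    have hgt : 0 ≤ g t := hg0.trans (hmono Set.self_mem_Ici ht ht)
    have heq : ∑ i ∈ insert a s, nodalWeight (insert a s) v i * Real.exp (v i * t) =
        Real.exp (v a * t) * g t := by
      rw [mul_sum]
      refine sum_congr rfl fun i _ => ?_
      rw [mul_left_comm, ← Real.exp_add]
      ring_nf
    rw [heq]
    exact mul_nonneg (Real.exp_pos _).le hgt

open Polynomial Lagrange in
theorem coeff_nodal_nonneg {ι : Type*} {s : Finset ι} {v : ι → ℝ}
    (hv : ∀ i ∈ s, v i ≤ 0) (k : ℕ) : 0 ≤ (nodal s v).coeff k := by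
  classical
  induction s using Finset.induction_on generalizing k with
  | empty => rw [nodal_empty, coeff_one]; split_ifs <;> norm_num
  | insert a s ha ih =>
    have ih' := ih fun i hi => hv i (mem_insert_of_mem hi)
    have hva := hv a (mem_insert_self a s)
    rw [nodal_insert_eq_nodal ha, sub_mul, coeff_sub, coeff_C_mul]
    have hX : 0 ≤ (X * nodal s v).coeff k := by
      cases k with
      | zero => simp
      | succ k => rw [coeff_X_mul]; exact ih' k
    exact sub_nonneg.mpr ((mul_nonpos_of_nonpos_of_nonneg hva (ih' k)).trans hX)

open Polynomial Lagrange in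
/-- The polynomial interpolating `x ↦ exp (x * t)` at nonpositive nodes has nonnegative
coefficients when `0 ≤ t`. -/
theorem coeff_interpolate_exp_nonneg {ι : Type*} [DecidableEq ι] {s : Finset ι} {v : ι → ℝ}
    (hinj : Set.InjOn v s) (hv : ∀ i ∈ s, v i ≤ 0) {t : ℝ} (ht : 0 ≤ t) (k : ℕ) :
    0 ≤ (interpolate s v fun i => Real.exp (v i * t)).coeff k := by
  induction s using Finset.induction_on with
  | empty => simp
  | insert a s ha ih =>
    have hs : ∀ i ∈ s, v i ≤ 0 := fun i hi => hv i (mem_insert_of_mem hi)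
    have hne : ∀ i ∈ s, v i ≠ v a := fun i hi h =>
      ha (hinj (mem_insert_of_mem hi) (mem_insert_self a s) h ▸ hi)
    rw [interpolate_insert_eq_add_nodal _ ha hne, coeff_add, coeff_C_mul]
    exact add_nonneg (ih (hinj.mono (by simp)) hs)
      (mul_nonneg (sum_nodalWeight_mul_exp_nonneg hinj ht) (coeff_nodal_nonneg hs k))

open Polynomial Lagrange in
theorem acoef_eq_coeff_nodal {R : Type*} [CommRing R] {n : ℕ} (lam : Fin n → R) {k : ℕ}
    (hk : k ≤ n) : acoef lam (k : ℤ) = (nodal univ lam).coeff k := by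
  have h := Multiset.prod_X_sub_C_coeff ((univ : Finset (Fin n)).val.map lam) (k := k) (by simpa)
  rw [Multiset.map_map, Finset.esymm_map_val] at h
  simp only [Multiset.card_map, card_val, card_univ, Fintype.card_fin] at h
  rw [acoef, if_pos (by simpa using hk), Int.toNat_natCast]
  exact h.symm

open Lagrange in
theorem nodal_removeEntry {R : Type*} [CommRing R] {n : ℕ} (lam : Fin n → R) (i : Fin n) :
    nodal univ (removeEntry lam i) = nodal (univ.erase i) lam := by
  cases n with
  | zero => exact i.elim0
  | succ m =>
    rw [nodal, nodal, ← compl_singleton, ← Fin.image_succAbove_univ,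
      prod_image Fin.succAbove_right_injective.injOn]
    rfl

open Lagrange in
/-- The Vandermonde basis functions are the coefficients of the polynomial interpolating
`x ↦ exp (x * t)` at the given nodes. -/
theorem vbasisR_eq_coeff_interpolate {n : ℕ} (lam : Fin n → ℝ) {k : ℕ} (hk : k < n) (t : ℝ) :
    vbasisR lam (k : ℤ) t = (interpolate univ lam fun i => Real.exp (lam i * t)).coeff k := by
  rw [vbasisR, interpolate_apply, Polynomial.finsetSum_coeff, mul_sum]
  refine sum_congr rfl fun i hi => ?_
  have hw : nodalWeight univ lam i =
      (-1) ^ (n - 1) * (∏ j ∈ univ.erase i, (lam j - lam i))⁻¹ := by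
    have hcard : #(univ.erase i) = n - 1 := by simp
    rw [nodalWeight, ← hcard, ← prod_const, ← prod_inv_distrib, ← prod_mul_distrib]
    refine prod_congr rfl fun j _ => ?_
    rw [← neg_sub (lam j), inv_neg, neg_one_mul]
  rw [acoef_eq_coeff_nodal _ (by omega), nodal_removeEntry,
    basis_eq_prod_sub_inv_mul_nodal_div hi, ← nodal_erase_eq_nodal_div hi, Polynomial.coeff_C_mul,
    Polynomial.coeff_C_mul, hw]
  ring

/-- Nonnegativity of Vandermonde basis functions for distinct negative real roots. -/
theorem vandermonde_basis_nonneg (n : ℕ) (lam : Fin n → ℝ)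
    (h : Function.Injective lam) (hneg : ∀ i, lam i < 0)
    (k : ℕ) (hk : k < n) (t : ℝ) (ht : 0 ≤ t) :
    0 ≤ vbasisR lam (k : ℤ) t := by
  rw [vbasisR_eq_coeff_interpolate lam hk]
  exact coeff_interpolate_exp_nonneg h.injOn (fun i _ => (hneg i).le) ht k
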